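/- Fix distinct atomic propositions P₀,…,Pₙ and let Φₙ be the CCTLb1 formula EF_{⋀_{i=0}^{n} #P_i ≥ 1} ⊤. Then: (a) for every Kripke structure S and state q, q ⊨ Φₙ iff there is a run from q along which each Pᵢ (0 ≤ i ≤ n) holds in at least one state; (b) the minimal size of a CTL formula equivalent to Φₙ is not bounded by any polynomial in n, even though |Φₙ| = O(n) with all integer constants equal to 1 (encoded in unary). Hence CCTLb1 with unary-encoded constants can be exponentially more succinct than CTL. -/

import Mathlib

open scoped Classical

noncomputable section

/-- A Kripke structure over atomic propositions indexed by `ℕ`;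
propositions `0,…,n` play the roles of `P₀,…,Pₙ`. -/
structure Kripke (Q : Type) where
  R : Q → Q → Prop
  total : ∀ q, ∃ q', R q q'
  label : Q → ℕ → Prop

/-- An (infinite) run of a Kripke structure. -/
def Kripke.Run {Q : Type} (S : Kripke Q) (ρ : ℕ → Q) : Prop :=
  ∀ i, S.R (ρ i) (ρ (i + 1))

/-- The strict prefix `ρ(0) ⋯ ρ(n-1)` of a run (`n` states). -/
def runPrefix {Q : Type} (ρ : ℕ → Q) (n : ℕ) : List Q :=
  (List.range n).map ρ

/-- The number of states of a finite prefix satisfying a predicate. -/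
def countSat {Q : Type} (p : Q → Prop) : List Q → ℕ
  | [] => 0
  | s :: t => (if p s then 1 else 0) + countSat p t

/-- Comparison operators `<, ≤, =, ≥, >`. -/
inductive Cmp where
  | lt | le | eq | ge | gt

def Cmp.eval : Cmp → ℕ → ℕ → Prop
  | .lt, a, b => a < b
  | .le, a, b => a ≤ b
  | .eq, a, b => a = b
  | .ge, a, b => a ≥ b
  | .gt, a, b => a > b

mutual
/-- CCTLb1 formulas (all coefficients are `1` in the formulas we build). -/
inductive CForm : Type where
  | atom : ℕ → CForm
  | and : CForm → CForm → CForm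
  | not : CForm → CForm
  | eu : CForm → Constr → CForm → CForm
  | au : CForm → Constr → CForm → CForm

inductive LinExp : Type where
  | term : ℕ → CForm → LinExp
  | add : LinExp → LinExp → LinExp

inductive Constr : Type where
  | atomic : LinExp → Cmp → ℕ → Constr
  | cand : Constr → Constr → Constr
  | cnot : Constr → Constr
end

mutual
/-- Satisfaction of a CCTLb formula at a state. -/
def sat {Q : Type} (S : Kripke Q) : CForm → Q → Prop
  | .atom p, q => S.label q p
  | .and φ ψ, q => sat S φ q ∧ sat S ψ q
  | .not φ, q => ¬ sat S φ q
  | .eu φ C ψ, q => ∃ ρ, S.Run ρ ∧ ρ 0 = q ∧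
      ∃ i, sat S ψ (ρ i) ∧ csat S C (runPrefix ρ i) ∧ ∀ j < i, sat S φ (ρ j)
  | .au φ C ψ, q => ∀ ρ, S.Run ρ → ρ 0 = q →
      ∃ i, sat S ψ (ρ i) ∧ csat S C (runPrefix ρ i) ∧ ∀ j < i, sat S φ (ρ j)
termination_by φ _ => sizeOf φ

def lval {Q : Type} (S : Kripke Q) : LinExp → List Q → ℕ
  | .term a φ, σ => a * countSat (fun s => sat S φ s) σ
  | .add e f, σ => lval S e σ + lval S f σ
termination_by e _ => sizeOf e

def csat {Q : Type} (S : Kripke Q) : Constr → List Q → Prop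
  | .atomic e c k, σ => c.eval (lval S e σ) k
  | .cand C D, σ => csat S C σ ∧ csat S D σ
  | .cnot C, σ => ¬ csat S C σ
termination_by C _ => sizeOf C
end

/-- The formula `⊤` (derived). -/
def ctop : CForm := .not (.and (.atom 0) (.not (.atom 0)))

/-- The atomic constraint `#Pᵢ ≥ 1`. -/
def atomC (i : ℕ) : Constr := .atomic (.term 1 (.atom i)) .ge 1

/-- The constraint `⋀_{i=0}^{n} #Pᵢ ≥ 1`. -/
def constrN : ℕ → Constr
  | 0 => atomC 0
  | n + 1 => .cand (atomC (n + 1)) (constrN n)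

/-- The CCTLb1 formula `Φₙ = EF_{⋀_{i=0}^{n} #Pᵢ ≥ 1} ⊤`. -/
def Phi (n : ℕ) : CForm := .eu ctop (constrN n) ctop

/-- CTL formulas. -/
inductive CTL : Type where
  | atom : ℕ → CTL
  | and : CTL → CTL → CTL
  | not : CTL → CTL
  | eu : CTL → CTL → CTL
  | au : CTL → CTL → CTL

/-- Satisfaction of a CTL formula at a state. -/
def CTL.sat {Q : Type} (S : Kripke Q) : CTL → Q → Prop
  | .atom p, q => S.label q p
  | .and φ ψ, q => CTL.sat S φ q ∧ CTL.sat S ψ q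
  | .not φ, q => ¬ CTL.sat S φ q
  | .eu φ ψ, q => ∃ ρ, S.Run ρ ∧ ρ 0 = q ∧
      ∃ i, CTL.sat S ψ (ρ i) ∧ ∀ j < i, CTL.sat S φ (ρ j)
  | .au φ ψ, q => ∀ ρ, S.Run ρ → ρ 0 = q →
      ∃ i, CTL.sat S ψ (ρ i) ∧ ∀ j < i, CTL.sat S φ (ρ j)

/-- Size (number of symbols) of a CTL formula. -/
def CTL.size : CTL → ℕ
  | .atom _ => 1
  | .and φ ψ => 1 + φ.size + ψ.size
  | .not φ => 1 + φ.size
  | .eu φ ψ => 1 + φ.size + ψ.size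
  | .au φ ψ => 1 + φ.size + ψ.size

section Semantics

variable {Q : Type} (S : Kripke Q)

theorem Kripke.exists_run (q : Q) : ∃ ρ, S.Run ρ ∧ ρ 0 = q := by
  choose f hf using S.total
  refine ⟨fun n => f^[n] q, fun i => ?_, rfl⟩
  simp only [Function.iterate_succ_apply']
  exact hf _

variable {S}

theorem Kripke.Run.tail {ρ : ℕ → Q} (h : S.Run ρ) : S.Run (fun n => ρ (n + 1)) :=
  fun i => h (i + 1)

theorem Kripke.Run.cons {ρ : ℕ → Q} (h : S.Run ρ) {q : Q} (hq : S.R q (ρ 0)) :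
    S.Run (fun n => Nat.casesOn n q ρ) := by
  intro i
  cases i with
  | zero => exact hq
  | succ i => exact h i

theorem CTL.sat_eu_iff {φ ψ : CTL} {q : Q} :
    CTL.sat S (.eu φ ψ) q ↔
      CTL.sat S ψ q ∨ (CTL.sat S φ q ∧ ∃ q', S.R q q' ∧ CTL.sat S (.eu φ ψ) q') := by
  constructor
  · rintro ⟨ρ, hρ, rfl, i, hi, hj⟩
    cases i with
    | zero => exact Or.inl hi
    | succ i =>
      exact Or.inr ⟨hj 0 i.succ_pos, ρ 1, hρ 0, fun n => ρ (n + 1), hρ.tail, rfl, i, hi,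
        fun j h => hj (j + 1) (by omega)⟩
  · rintro (h | ⟨h, q', hq, ρ, hρ, rfl, i, hi, hj⟩)
    · obtain ⟨ρ, hρ, rfl⟩ := S.exists_run q
      exact ⟨ρ, hρ, rfl, 0, h, fun j hj => absurd hj j.not_lt_zero⟩
    · refine ⟨_, hρ.cons hq, rfl, i + 1, hi, fun j h' => ?_⟩
      cases j with
      | zero => exact h
      | succ j => exact hj j (by omega)

theorem CTL.sat_au_iff {φ ψ : CTL} {q : Q} :
    CTL.sat S (.au φ ψ) q ↔
      CTL.sat S ψ q ∨ (CTL.sat S φ q ∧ ∀ q', S.R q q' → CTL.sat S (.au φ ψ) q') := by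
  constructor
  · intro h
    refine or_iff_not_imp_left.2 fun hψ => ⟨?_, fun q' hq ρ hρ h0 => ?_⟩
    · obtain ⟨ρ, hρ, rfl⟩ := S.exists_run q
      obtain ⟨i, hi, hj⟩ := h ρ hρ rfl
      cases i with
      | zero => exact absurd hi hψ
      | succ i => exact hj 0 i.succ_pos
    · subst h0
      obtain ⟨i, hi, hj⟩ := h _ (hρ.cons hq) rfl
      cases i with
      | zero => exact absurd hi hψ
      | succ i => exact ⟨i, hi, fun j h' => hj (j + 1) (by omega)⟩
  · rintro (h | ⟨h, hs⟩) ρ hρ rfl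
    · exact ⟨0, h, fun j hj => absurd hj j.not_lt_zero⟩
    · obtain ⟨i, hi, hj⟩ := hs (ρ 1) (hρ 0) _ hρ.tail rfl
      refine ⟨i + 1, hi, fun j h' => ?_⟩
      cases j with
      | zero => exact h
      | succ j => exact hj j (by omega)

theorem one_le_countSat_iff {p : Q → Prop} {l : List Q} :
    1 ≤ countSat p l ↔ ∃ s ∈ l, p s := by
  induction l with
  | nil => simp [countSat]
  | cons s t ih =>
    by_cases h : p s
    · simp [countSat, h]
    · simp [countSat, h, ih]

theorem csat_atomC_iff {ρ : ℕ → Q} {i n : ℕ} :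
    csat S (atomC i) (runPrefix ρ n) ↔ ∃ j < n, S.label (ρ j) i := by
  simp only [atomC, csat, lval, Cmp.eval, one_mul, ge_iff_le, one_le_countSat_iff, sat]
  simp [runPrefix]

theorem csat_constrN_iff {ρ : ℕ → Q} {N n : ℕ} :
    csat S (constrN N) (runPrefix ρ n) ↔ ∀ i ≤ N, ∃ j < n, S.label (ρ j) i := by
  induction N with
  | zero => simp [constrN, csat_atomC_iff]
  | succ N ih =>
    rw [constrN, csat, csat_atomC_iff, ih]
    constructor
    · rintro ⟨h, h'⟩ i hi
      rcases Nat.le_succ_iff.1 hi with hi | rfl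
      · exact h' i hi
      · exact h
    · exact fun h => ⟨h _ le_rfl, fun i hi => h i (by omega)⟩

theorem sat_ctop (q : Q) : sat S ctop q := by
  simp [ctop, sat]

theorem sat_Phi_iff {n : ℕ} {q : Q} :
    sat S (Phi n) q ↔ ∃ ρ, S.Run ρ ∧ ρ 0 = q ∧ ∀ i ≤ n, ∃ j, S.label (ρ j) i := by
  simp only [Phi, sat, csat_constrN_iff, sat_ctop, true_and, implies_true, and_true]
  refine exists_congr fun ρ => and_congr_right fun _ => and_congr_right fun _ => ?_
  constructor
  · rintro ⟨m, hm⟩ i hi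
    obtain ⟨j, -, hj⟩ := hm i hi
    exact ⟨j, hj⟩
  · intro h
    choose f hf using h
    refine ⟨(Finset.range (n + 1)).attach.sup
      (fun i => f i.1 (Nat.lt_succ_iff.1 (Finset.mem_range.1 i.2))) + 1, fun i hi => ?_⟩
    refine ⟨f i hi, Nat.lt_succ_of_le ?_, hf i hi⟩
    exact Finset.le_sup (f := fun i : {x // x ∈ Finset.range (n + 1)} =>
      f i.1 (Nat.lt_succ_iff.1 (Finset.mem_range.1 i.2)))
      (Finset.mem_attach _ ⟨i, Finset.mem_range.2 (Nat.lt_succ_of_le hi)⟩)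

end Semantics

section TreeStructure

/-- States of the structure witnessing the lower bound: a depth along a branch of the binary
tree of height `m`, with a flag telling whether the branch can still be completed. -/
structure TreeState (m : ℕ) where
  flag : Bool
  word : Fin m → Bool
  level : Fin (m + 1)

instance (m : ℕ) : Fintype (TreeState m) :=
  Fintype.ofInjective (fun q => (q.flag, q.word, q.level)) (by
    rintro ⟨a, b, c⟩ ⟨a', b', c'⟩ h
    simpa using h)

variable {m : ℕ}

/-- Two branches have the same prefix of length `k`. -/
def Agree (k : ℕ) (v w : Fin m → Bool) : Prop :=
  ∀ i : Fin m, (i : ℕ) < k → v i = w i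

theorem Agree.symm {k : ℕ} {v w : Fin m → Bool} (h : Agree k v w) : Agree k w v :=
  fun i hi => (h i hi).symm

theorem Agree.trans {k : ℕ} {u v w : Fin m → Bool} (h : Agree k u v) (h' : Agree k v w) :
    Agree k u w :=
  fun i hi => (h i hi).trans (h' i hi)

theorem Agree.mono {k l : ℕ} {v w : Fin m → Bool} (h : Agree k v w) (hl : l ≤ k) :
    Agree l v w :=
  fun i hi => h i (hi.trans_le hl)

/-- The Kripke structure on `TreeState m`. A step descends to any deeper state with the same
traversed prefix, but a step from an unflagged state to a flagged one must skip a level or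
change the branch. Below level `m` a state shows the current bit of its branch; a flagged
state at level `m` shows the complements of all bits. -/
def treeKripke (m : ℕ) : Kripke (TreeState m) where
  R q q' := ((q.level : ℕ) = m ∧ q' = q) ∨
    ((q.level : ℕ) < q'.level ∧ Agree q.level q.word q'.word ∧
      (q'.flag = true → (q'.level : ℕ) = q.level + 1 → Agree (q.level + 1) q.word q'.word →
        q.flag = true ∧ q'.word = q.word))
  total q := by
    by_cases h : (q.level : ℕ) = m
    · exact ⟨q, Or.inl ⟨h, rfl⟩⟩
    · refine ⟨⟨false, q.word, Fin.last m⟩, Or.inr ⟨?_, fun _ _ => rfl, by simp⟩⟩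
      have := q.level.is_lt
      simp only [Fin.val_last]
      omega
  label q p := (∃ i : Fin m, (i : ℕ) = q.level ∧ p = 2 * i + (q.word i).toNat) ∨
    ((q.level : ℕ) = m ∧ q.flag = true ∧ ∃ i : Fin m, p = 2 * i + (!q.word i).toNat)

/-- The state at level `min k m` of the branch `v`. -/
def treeNode (b : Bool) (v : Fin m → Bool) (k : ℕ) : TreeState m :=
  ⟨b, v, ⟨min k m, by omega⟩⟩

theorem treeKripke_R_of_lt {b : Bool} {v w : Fin m → Bool} {k l : ℕ} (hk : k < l) (hl : l ≤ m)
    (hvw : Agree k v w) (h : b = true → l = k + 1 → ¬ Agree (k + 1) v w) :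
    (treeKripke m).R (treeNode false v k) (treeNode b w l) := by
  have h1 : min k m = k := by omega
  have h2 : min l m = l := by omega
  refine Or.inr ⟨?_, ?_, ?_⟩
  · simpa [treeNode, h1, h2] using hk
  · simpa [treeNode, h1] using hvw
  · simp only [treeNode, h1, h2]
    exact fun hb he ha => absurd ha (h hb he)

theorem treeKripke_R_true_iff {v : Fin m → Bool} {k : ℕ} (hk : k < m) {q : TreeState m} :
    (treeKripke m).R (treeNode true v k) q ↔
      (treeKripke m).R (treeNode false v k) q ∨ q = treeNode true v (k + 1) := by
  have h1 : min k m = k := by omega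
  have h2 : min (k + 1) m = k + 1 := by omega
  obtain ⟨b, w, l, hl⟩ := q
  simp only [treeKripke, treeNode, h1, h2, TreeState.mk.injEq, Fin.mk.injEq, hk.ne, false_and,
    false_or, true_and, Bool.false_eq_true]
  constructor
  · rintro ⟨h, ha, himp⟩
    by_cases hc : b = true ∧ l = k + 1 ∧ Agree (k + 1) v w
    · exact Or.inr ⟨hc.1, himp hc.1 hc.2.1 hc.2.2, hc.2.1⟩
    · exact Or.inl ⟨h, ha, fun x y z => hc ⟨x, y, z⟩⟩
  · rintro (⟨h, ha, himp⟩ | ⟨rfl, rfl, rfl⟩)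
    · exact ⟨h, ha, fun x y z => (himp x y z).elim⟩
    · exact ⟨by omega, fun _ _ => rfl, fun _ _ _ => rfl⟩

theorem treeKripke_label_eq {v : Fin m → Bool} {k : ℕ} (hk : k < m) (p : ℕ) :
    (treeKripke m).label (treeNode true v k) p ↔ (treeKripke m).label (treeNode false v k) p := by
  have h1 : min k m = k := by omega
  simp [treeKripke, treeNode, h1, hk.ne]

theorem exists_run_of_flag (v : Fin m → Bool) :
    ∃ ρ, (treeKripke m).Run ρ ∧ ρ 0 = treeNode true v 0 ∧
      ∀ p < 2 * m, ∃ j, (treeKripke m).label (ρ j) p := by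
  refine ⟨fun j => treeNode true v j, fun j => ?_, rfl, fun p hp => ?_⟩
  · rcases lt_or_ge j m with h | h
    · exact (treeKripke_R_true_iff h).2 (Or.inr rfl)
    · left
      simp only [treeNode, TreeState.mk.injEq, Fin.mk.injEq, true_and]
      omega
  · obtain ⟨i, hi⟩ : ∃ i : Fin m, (i : ℕ) = p / 2 := ⟨⟨p / 2, by omega⟩, rfl⟩
    by_cases hv : p % 2 = (v i).toNat
    · refine ⟨i, Or.inl ⟨i, ?_, ?_⟩⟩
      · simp only [treeNode]
        omega
      · simp only [treeNode]
        omega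
    · refine ⟨m, Or.inr ⟨by simp [treeNode], rfl, i, ?_⟩⟩
      simp only [treeNode]
      cases h : v i <;> simp [h] at hv ⊢ <;> omega

theorem Kripke.Run.treeKripke_step {ρ : ℕ → TreeState m} (hρ : (treeKripke m).Run ρ) {a b : ℕ}
    (hab : a < b) :
    (((ρ a).level : ℕ) = m ∧ ρ b = ρ a) ∨
      (((ρ a).level : ℕ) < (ρ b).level ∧ Agree (ρ a).level (ρ a).word (ρ b).word) := by
  induction b, hab using Nat.le_induction with
  | base => exact (hρ a).imp id fun h => ⟨h.1, h.2.1⟩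
  | succ b hb ih =>
    rcases hρ b with ⟨h, h'⟩ | ⟨h, h', -⟩
    · rwa [h']
    · have hlt := (ρ (b + 1)).level.is_lt
      rcases ih with ⟨i, i'⟩ | ⟨i, i'⟩
      · rw [i'] at h
        omega
      · exact Or.inr ⟨i.trans h, i'.trans (h'.mono i.le)⟩

theorem Kripke.Run.treeKripke_eq {ρ : ℕ → TreeState m} (hρ : (treeKripke m).Run ρ) {a b : ℕ}
    (h : ((ρ a).level : ℕ) = (ρ b).level) : ρ a = ρ b := by
  rcases lt_trichotomy a b with hab | rfl | hab
  · rcases hρ.treeKripke_step hab with h' | h'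
    · exact h'.2.symm
    · omega
  · rfl
  · rcases hρ.treeKripke_step hab with h' | h'
    · exact h'.2
    · omega

theorem Kripke.Run.exists_missing {ρ : ℕ → TreeState m} (hρ : (treeKripke m).Run ρ)
    (hm : 0 < m) {v : Fin m → Bool} (h0 : ρ 0 = treeNode false v 0) :
    ∃ p < 2 * m, ∀ j, ¬ (treeKripke m).label (ρ j) p := by
  by_contra! H
  have seen : ∀ (i : Fin m) (c : Bool), ∃ j,
      (((ρ j).level : ℕ) = i ∧ (ρ j).word i = c) ∨
      (((ρ j).level : ℕ) = m ∧ (ρ j).flag = true ∧ (ρ j).word i = !c) := by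
    intro i c
    obtain ⟨j, hj⟩ := H (2 * i + c.toNat) (by have := c.toNat_le; omega)
    refine ⟨j, ?_⟩
    have key : ∀ (i' : Fin m) (d : Bool), 2 * (i : ℕ) + c.toNat = 2 * i' + d.toNat →
        i' = i ∧ d = c := by
      intro i' d hd
      have h1 := c.toNat_le
      have h2 := d.toNat_le
      exact ⟨Fin.ext (by omega), by cases c <;> cases d <;> simp_all <;> omega⟩
    rcases hj with ⟨i', hi', hp⟩ | ⟨hl, hf, i', hp⟩
    · obtain ⟨rfl, hd⟩ := key _ _ hp
      exact Or.inl ⟨hi'.symm, hd⟩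
    · obtain ⟨rfl, hd⟩ := key _ _ hp
      exact Or.inr ⟨hl, hf, by rw [← hd, Bool.not_not]⟩
  have visit : ∀ i : Fin m, ∃ a b, ((ρ a).level : ℕ) = i ∧ ((ρ b).level : ℕ) = m ∧
      (ρ b).flag = true ∧ (ρ b).word i = (ρ a).word i := by
    intro i
    obtain ⟨a, ⟨ha, ha'⟩ | ⟨ha, hf, ha'⟩⟩ := seen i true <;>
    obtain ⟨b, ⟨hb, hb'⟩ | ⟨hb, hf', hb'⟩⟩ := seen i false
    · rw [hρ.treeKripke_eq (ha.trans hb.symm), hb'] at ha'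
      simp at ha'
    · exact ⟨a, b, ha, hb, hf', by simp [ha', hb']⟩
    · exact ⟨b, a, hb, ha, hf, by simp [ha', hb']⟩
    · rw [hρ.treeKripke_eq (ha.trans hb.symm), hb'] at ha'
      simp at ha'
  obtain ⟨-, e, -, he, hef, -⟩ := visit ⟨0, hm⟩
  have word_end : ∀ a, Agree (ρ a).level (ρ a).word (ρ e).word := by
    intro a
    rcases lt_trichotomy a e with h | rfl | h
    · rcases hρ.treeKripke_step h with h' | h'
      · rw [h'.2]
        exact fun _ _ => rfl
      · exact h'.2
    · exact fun _ _ => rfl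
    · rcases hρ.treeKripke_step h with h' | h'
      · rw [h'.2]
        exact fun _ _ => rfl
      · have := (ρ a).level.is_lt
        omega
  have unflagged : ∀ i ≤ m, ∀ a, ((ρ a).level : ℕ) = i → (ρ a).flag = false := by
    intro i
    induction i with
    | zero =>
      intro _ a ha
      have : ρ a = ρ 0 := hρ.treeKripke_eq (by rw [ha, h0]; simp [treeNode])
      rw [this, h0]
      rfl
    | succ i ih =>
      intro hi a ha
      obtain ⟨c, d, hc, hd, -, hcd⟩ := visit ⟨i, hi⟩
      simp only at hc
      rw [hρ.treeKripke_eq (hd.trans he.symm)] at hcd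
      have hflag := ih (by omega) c hc
      have hca : c < a := by
        by_contra! hle
        rcases hle.lt_or_eq with h | rfl
        · rcases hρ.treeKripke_step h with h' | h'
          · rw [h'.2] at hc
            omega
          · omega
        · omega
      rcases hρ c with h | ⟨hlt, -, himp⟩
      · omega
      have hlvl : ((ρ (c + 1)).level : ℕ) = i + 1 := by
        rcases (Nat.succ_le_of_lt hca).lt_or_eq with h | h
        · rcases hρ.treeKripke_step h with h' | h'
          · rw [Nat.succ_eq_add_one] at h'
            rw [← ha, h'.2]
          · rw [Nat.succ_eq_add_one] at h'
            omega
        · rw [← ha, ← h]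
      rw [← hρ.treeKripke_eq (hlvl.trans ha.symm)]
      by_contra hf
      rw [Bool.not_eq_false] at hf
      have hagree : Agree ((ρ c).level + 1) (ρ c).word (ρ (c + 1)).word := by
        have h1 := word_end (c + 1)
        have h2 := word_end c
        rw [hlvl] at h1
        rw [hc] at h2 ⊢
        refine Agree.trans (fun j hj => ?_) h1.symm
        rcases Nat.lt_succ_iff_lt_or_eq.1 hj with h | h
        · exact h2 j h
        · obtain rfl : j = ⟨i, hi⟩ := Fin.ext h
          exact hcd.symm
      have := (himp hf (by omega) hagree).1
      rw [hflag] at this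
      exact Bool.false_ne_true this
  have := unflagged m le_rfl e he
  rw [hef] at this
  exact Bool.false_ne_true this.symm

end TreeStructure

section LowerBound

variable {m : ℕ}

/-- `X` distinguishes the flagged from the unflagged state of branch `v` at level `k`. -/
def Separates (X : TreeState m → Prop) (v : Fin m → Bool) (k : ℕ) : Prop :=
  ¬ (X (treeNode true v k) ↔ X (treeNode false v k))

/-- `X` holds at the flagged next state of branch `v` but at no successor of the unflagged
state of `v` at level `k`. -/
def Advances (X : TreeState m → Prop) (v : Fin m → Bool) (k : ℕ) : Prop :=
  (∀ q, (treeKripke m).R (treeNode false v k) q → ¬ X q) ∧ X (treeNode true v (k + 1))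

/-- An assignment of levels to a set of branches, no two of which are both strictly deeper
than the point where they diverge. -/
structure IsFront (D : Finset (Fin m → Bool)) (k : (Fin m → Bool) → ℕ) : Prop where
  lt : ∀ v ∈ D, k v < m
  agree : ∀ v ∈ D, ∀ w ∈ D, Agree (min (k v) (k w)) v w

theorem IsFront.subset {D D' : Finset (Fin m → Bool)} {k : (Fin m → Bool) → ℕ}
    (h : IsFront D k) (hD : D' ⊆ D) : IsFront D' k :=
  ⟨fun v hv => h.lt v (hD hv), fun v hv w hw => h.agree v (hD hv) w (hD hw)⟩

variable {X : TreeState m → Prop} {v w : Fin m → Bool} {j k : ℕ}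

theorem Advances.separates_succ (h : Advances X v k) (hk : k + 1 ≤ m) : Separates X v (k + 1) := by
  intro hiff
  exact h.1 _ (treeKripke_R_of_lt k.lt_succ_self hk (fun _ _ => rfl) (by simp)) (hiff.1 h.2)

theorem Advances.agree_succ_of_separates (h : Advances X v k) (hvw : Agree k v w) (hkj : k < j)
    (hj : j < m) (hw : Separates X w j) : Agree (k + 1) v w := by
  by_contra hc
  refine hw (iff_of_false (h.1 _ ?_) (h.1 _ ?_))
  · exact treeKripke_R_of_lt hkj hj.le hvw fun _ _ => hc
  · exact treeKripke_R_of_lt hkj hj.le hvw (by simp)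

theorem Advances.eq_and_agree (h : Advances X v k) (hw : Advances X w j) (hvw : Agree k v w)
    (hkj : k ≤ j) (hj : j < m) : j = k ∧ Agree (k + 1) v w := by
  by_contra hc
  refine h.1 _ (treeKripke_R_of_lt (by omega) hj hvw fun _ hjk ha => hc ⟨?_, ha⟩) hw.2
  omega

theorem IsFront.eq_and_agree {D : Finset (Fin m → Bool)} {k : (Fin m → Bool) → ℕ}
    (hD : IsFront D k) (hvD : v ∈ D) (hwD : w ∈ D) (hv : Advances X v (k v))
    (hw : Advances X w (k w)) : k w = k v ∧ Agree (k v + 1) v w := by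
  have ha := hD.agree v hvD w hwD
  rcases le_total (k v) (k w) with hle | hle
  · rw [min_eq_left hle] at ha
    exact hv.eq_and_agree hw ha hle (hD.lt w hwD)
  · rw [min_eq_right hle] at ha
    obtain ⟨h1, h2⟩ := hw.eq_and_agree hv ha.symm hle (hD.lt v hvD)
    rw [h1]
    exact ⟨rfl, h2.symm⟩

theorem IsFront.card_le_of_separates {Y Z : TreeState m → Prop} {a b : ℕ}
    (hX : ∀ v k, k < m → Separates X v k → Separates Y v k ∨ Separates Z v k ∨ Advances X v k)
    (hY : ∀ D k, IsFront D k → (∀ v ∈ D, Separates Y v (k v)) → D.card ≤ a)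
    (hZ : ∀ D k, IsFront D k → (∀ v ∈ D, Separates Z v (k v)) → D.card ≤ b)
    {D : Finset (Fin m → Bool)} {k : (Fin m → Bool) → ℕ}
    (hD : IsFront D k) (hsep : ∀ v ∈ D, Separates X v (k v)) : D.card ≤ 1 + a + b := by
  induction hs : ∑ v ∈ D, (m - k v) using Nat.strong_induction_on generalizing k with
  | _ s ih =>
  set E := D.filter fun v => Advances X v (k v) with hE
  have hcard : D.card ≤ a + b + E.card := by
    have hsub : D ⊆ D.filter (fun v => Separates Y v (k v)) ∪
        D.filter (fun v => Separates Z v (k v)) ∪ E := by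
      intro v hv
      simp only [hE, Finset.mem_union, Finset.mem_filter, hv, true_and]
      rcases hX v (k v) (hD.lt v hv) (hsep v hv) with h | h | h <;> tauto
    refine (Finset.card_le_card hsub).trans ((Finset.card_union_le _ _).trans ?_)
    gcongr
    refine (Finset.card_union_le _ _).trans (add_le_add ?_ ?_)
    · exact hY _ k (hD.subset (Finset.filter_subset _ _)) fun v hv => (Finset.mem_filter.1 hv).2
    · exact hZ _ k (hD.subset (Finset.filter_subset _ _)) fun v hv => (Finset.mem_filter.1 hv).2
  rcases le_or_gt E.card 1 with h1 | h1
  · omega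
  have hEE : ∀ v ∈ E, ∀ w ∈ E, k w = k v ∧ Agree (k v + 1) v w := by
    intro v hv w hw
    rw [hE, Finset.mem_filter] at hv hw
    exact hD.eq_and_agree hv.1 hw.1 hv.2 hw.2
  have hlt : ∀ v ∈ E, k v + 1 < m := by
    intro v hv
    have hvm := hD.lt v (Finset.mem_filter.1 hv).1
    by_contra hc
    obtain ⟨w, hw, hne⟩ := Finset.exists_mem_ne h1 v
    exact hne (funext fun i => ((hEE v hv w hw).2 i (by omega)).symm)
  let k' : (Fin m → Bool) → ℕ := fun v => if v ∈ E then k v + 1 else k v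
  have hk' : ∀ v ∈ E, k' v = k v + 1 := fun v hv => if_pos hv
  have hk'' : ∀ v ∉ E, k' v = k v := fun v hv => if_neg hv
  have hmixed : ∀ v ∈ E, ∀ w ∈ D, w ∉ E → Agree (min (k' v) (k' w)) v w := by
    intro v hv w hwD hw
    have hvD := Finset.mem_filter.1 hv
    have ha := hD.agree v hvD.1 w hwD
    rw [hk' v hv, hk'' w hw]
    rcases le_or_gt (k w) (k v) with h | h
    · exact ha.mono (by omega)
    · rw [min_eq_left h.le] at ha
      exact (hvD.2.agree_succ_of_separates ha h (hD.lt w hwD) (hsep w hwD)).mono (by omega)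
  obtain ⟨u, hu⟩ : E.Nonempty := Finset.card_pos.1 (by omega)
  refine ih (∑ v ∈ D, (m - k' v)) ?_ (k := k') ⟨?_, ?_⟩ ?_ rfl
  · rw [← hs]
    refine Finset.sum_lt_sum (fun v _ => ?_) ⟨u, (Finset.mem_filter.1 hu).1, ?_⟩
    · by_cases hv : v ∈ E
      · rw [hk' v hv]
        omega
      · rw [hk'' v hv]
    · have := hlt u hu
      rw [hk' u hu]
      omega
  · intro v hv
    by_cases hvE : v ∈ E
    · rw [hk' v hvE]
      exact hlt v hvE
    · rw [hk'' v hvE]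
      exact hD.lt v hv
  · intro v hv w hw
    by_cases hvE : v ∈ E <;> by_cases hwE : w ∈ E
    · rw [hk' v hvE]
      exact (hEE v hvE w hwE).2.mono (min_le_left _ _)
    · exact hmixed v hvE w hw hwE
    · rw [min_comm]
      exact (hmixed w hwE v hv hvE).symm
    · rw [hk'' v hvE, hk'' w hwE]
      exact hD.agree v hv w hw
  · intro v hv
    by_cases hvE : v ∈ E
    · rw [hk' v hvE]
      exact (Finset.mem_filter.1 hvE).2.separates_succ (hlt v hvE).le
    · rw [hk'' v hvE]
      exact hsep v hv

theorem separates_not_iff : Separates (fun q => ¬ X q) v k ↔ Separates X v k := by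
  simp only [Separates, not_iff_not]

theorem IsFront.card_le_size (φ : CTL) {D : Finset (Fin m → Bool)} {k : (Fin m → Bool) → ℕ}
    (hD : IsFront D k) (hsep : ∀ v ∈ D, Separates (CTL.sat (treeKripke m) φ) v (k v)) :
    D.card ≤ φ.size := by
  induction φ generalizing D k with
  | atom p =>
    have : D = ∅ := Finset.eq_empty_of_forall_notMem fun v hv =>
      hsep v hv (treeKripke_label_eq (hD.lt v hv) p)
    simp [this]
  | not φ ih =>
    have := ih hD fun v hv => separates_not_iff.1 (hsep v hv)
    rw [CTL.size]
    omega
  | and φ ψ ihφ ihψ =>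
    refine IsFront.card_le_of_separates (fun v k _ h => ?_) (fun _ _ h h' => ihφ h h')
      (fun _ _ h h' => ihψ h h') hD hsep
    simp only [Separates, CTL.sat] at h ⊢
    tauto
  | eu φ ψ ihφ ihψ =>
    refine IsFront.card_le_of_separates (fun v k hk h => ?_) (fun _ _ h h' => ihφ h h')
      (fun _ _ h h' => ihψ h h') hD hsep
    by_contra! hc
    obtain ⟨hφ, hψ, hadv⟩ := hc
    simp only [Separates, not_not] at hφ hψ
    refine h ?_
    rw [CTL.sat_eu_iff, CTL.sat_eu_iff (q := treeNode false v k), hφ, hψ]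
    refine or_congr_right (and_congr_right fun _ => ⟨?_, ?_⟩)
    · rintro ⟨q, hq, hqX⟩
      by_contra! hc
      rcases (treeKripke_R_true_iff hk).1 hq with hq | rfl
      · exact hc q hq hqX
      · exact hadv ⟨hc, hqX⟩
    · rintro ⟨q, hq, hqX⟩
      exact ⟨q, (treeKripke_R_true_iff hk).2 (Or.inl hq), hqX⟩
  | au φ ψ ihφ ihψ =>
    refine IsFront.card_le_of_separates (X := fun q => ¬ CTL.sat (treeKripke m) (.au φ ψ) q)
      (fun v k hk h => ?_) (fun _ _ h h' => ihφ h h')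
      (fun _ _ h h' => ihψ h h') hD fun v hv => separates_not_iff.2 (hsep v hv)
    rw [separates_not_iff] at h
    by_contra! hc
    obtain ⟨hφ, hψ, hadv⟩ := hc
    simp only [Separates, not_not] at hφ hψ
    refine h ?_
    rw [CTL.sat_au_iff, CTL.sat_au_iff (q := treeNode false v k), hφ, hψ]
    refine or_congr_right (and_congr_right fun _ => ⟨?_, ?_⟩)
    · exact fun hX q hq => hX q ((treeKripke_R_true_iff hk).2 (Or.inl hq))
    · intro hX q hq
      rcases (treeKripke_R_true_iff hk).1 hq with hq | rfl
      · exact hX q hq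
      · by_contra hqX
        exact hadv ⟨fun q hq => not_not.2 (hX q hq), hqX⟩

theorem two_pow_le_size {φ : CTL} (hm : 0 < m)
    (h : ∀ q, CTL.sat (treeKripke m) φ q ↔ sat (treeKripke m) (Phi (2 * m - 1)) q) :
    2 ^ m ≤ φ.size := by
  have := IsFront.card_le_size (D := Finset.univ) (k := fun _ => 0) φ
    ⟨fun _ _ => hm, fun _ _ _ _ i hi => absurd hi (by simp)⟩ fun v _ => ?_
  · simpa using this
  · simp only [Separates, h, sat_Phi_iff]
    intro hiff
    obtain ⟨ρ, hρ, h0, hl⟩ := exists_run_of_flag v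
    obtain ⟨ρ', hρ', h0', hl'⟩ := hiff.1 ⟨ρ, hρ, h0, fun i hi => hl i (by omega)⟩
    obtain ⟨p, hp, hmiss⟩ := hρ'.exists_missing hm h0'
    obtain ⟨j, hj⟩ := hl' p (by omega)
    exact hmiss j hj

end LowerBound

theorem Polynomial.exists_eval_lt_two_pow (p : Polynomial ℕ) : ∃ n : ℕ, p.eval n < 2 ^ n := by
  have h : (fun n : ℕ => ((p.eval n : ℕ) : ℝ)) =o[Filter.atTop] fun n : ℕ => (2 : ℝ) ^ n := by
    induction p using Polynomial.induction_on' with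
    | add p q hp hq => simpa using hp.add hq
    | monomial d a =>
      simpa using (isLittleO_pow_const_const_pow_of_one_lt d one_lt_two).const_mul_left (a : ℝ)
  obtain ⟨n, hn⟩ := (h.bound (c := 1 / 2) (by norm_num)).exists
  refine ⟨n, ?_⟩
  rw [Real.norm_of_nonneg (by positivity), Real.norm_of_nonneg (by positivity)] at hn
  have h2 : (0 : ℝ) < 2 ^ n := by positivity
  have : ((p.eval n : ℕ) : ℝ) < 2 ^ n := by linarith
  exact_mod_cast this

/-- (a) `Φₙ` holds at `q` iff some run from `q` sees each
`Pᵢ` (`0 ≤ i ≤ n`) at least once; (b) no polynomial in `n` bounds the size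
of CTL formulas equivalent to `Φₙ`. -/
theorem Phi_semantics_and_ctl_blowup :
    (∀ (n : ℕ) (Q : Type) [Fintype Q] (S : Kripke Q) (q : Q),
        sat S (Phi n) q ↔
          ∃ ρ, S.Run ρ ∧ ρ 0 = q ∧ ∀ i ≤ n, ∃ j, S.label (ρ j) i) ∧
    ¬ ∃ p : Polynomial ℕ, ∀ n : ℕ, ∃ φ' : CTL,
        (∀ (Q : Type) [Fintype Q] (S : Kripke Q) (q : Q),
            CTL.sat S φ' q ↔ sat S (Phi n) q) ∧
        φ'.size ≤ p.eval n := by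
  refine ⟨fun n Q _ S q => sat_Phi_iff, ?_⟩
  rintro ⟨p, hp⟩
  obtain ⟨n, hn⟩ := (p.comp (2 * Polynomial.X + 1)).exists_eval_lt_two_pow
  obtain ⟨φ, hφ, hsize⟩ := hp (2 * (n + 1) - 1)
  have h := two_pow_le_size n.succ_pos fun q => hφ (TreeState (n + 1)) (treeKripke (n + 1)) q
  have hlt : 2 ^ n < 2 ^ (n + 1) := Nat.pow_lt_pow_right one_lt_two n.lt_succ_self
  have he : 2 * (n + 1) - 1 = 2 * n + 1 := by omega
  rw [he] at hsize
  simp only [Polynomial.eval_comp, Polynomial.eval_add, Polynomial.eval_mul, Polynomial.eval_X,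
    Polynomial.eval_one, Polynomial.eval_ofNat] at hn
  omega
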